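/- With α := √5 − 2 and γ := (√5 − 1)/2, the measure μ_sb is a probability distribution on ℤ²; if (X,Y) ∼ μ_sb then E[X] = E[Y] = 0, E[X²] = 2(2+√5), E[Y²] = 1+√5 and E[XY] = −(2+√5); consequently the correlation coefficient of (X,Y) equals −(1+√5)/4 ≈ −0.8090. -/

import Mathlib

attribute [local instance] Classical.propDecidable

noncomputable section

/-- `α = √5 - 2`. -/
def semiα : ℝ := Real.sqrt 5 - 2

/-- `γ = (√5 - 1)/2`. -/
def semiγ : ℝ := (Real.sqrt 5 - 1) / 2

/-- The step distribution `μ_sb`: `(-i,1) ↦ αγ^i` for `i ≥ 0` and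
`(i,-i+1) ↦ αγ^i` for `i ≥ 1`. -/
def wSemi (d : ℤ × ℤ) : ℝ :=
  if d.1 ≤ 0 ∧ d.2 = 1 then semiα * semiγ ^ (-d.1).toNat
  else if 1 ≤ d.1 ∧ d.2 = 1 - d.1 then semiα * semiγ ^ d.1.toNat
  else 0

lemma aux_sq : Real.sqrt 5 * Real.sqrt 5 = 5 := Real.mul_self_sqrt (by norm_num)

lemma aux_lo : 2 < Real.sqrt 5 := by
  rw [Real.lt_sqrt] <;> norm_num

lemma aux_hi : Real.sqrt 5 < 3 := by
  rw [Real.sqrt_lt'] <;> norm_num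

lemma semiγ_pos : 0 < semiγ := by
  have := aux_lo
  unfold semiγ; linarith

lemma semiγ_lt : semiγ < 1 := by
  have := aux_hi
  unfold semiγ; linarith

lemma semiα_pos : 0 < semiα := by
  have := aux_lo
  unfold semiα; linarith

lemma inv_eq : (1 - semiγ)⁻¹ = (3 + Real.sqrt 5) / 2 := by
  have h := semiγ_lt
  apply inv_eq_of_mul_eq_one_right
  unfold semiγ
  linear_combination (-1/4) * aux_sq

lemma hasSum_poly (a b c : ℝ) :
    HasSum (fun n : ℕ => (a + b * n + c * (n:ℝ)^2) * (semiα * semiγ ^ n))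
      (semiα * (a * ((3 + Real.sqrt 5) / 2) + b * (2 + Real.sqrt 5)
        + c * (9 + 4 * Real.sqrt 5))) := by
  have hn : ‖semiγ‖ < 1 := by
    rw [Real.norm_of_nonneg semiγ_pos.le]; exact semiγ_lt
  have h0 := hasSum_geometric_of_norm_lt_one hn
  have h1 := hasSum_coe_mul_geometric_of_norm_lt_one hn
  have h2 := hasSum_choose_mul_geometric_of_norm_lt_one 2 hn
  have e := inv_eq
  have q := aux_sq
  have hE := (((h0.mul_left (a - 2 * c)).add (h1.mul_left (b - 3 * c))).add
    (h2.mul_left (2 * c))).mul_left semiα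
  convert hE using 1
  · rfl
  · funext n
    have : (((n + 2).choose 2 : ℕ) : ℝ) = ((n:ℝ) + 2) * (n + 1) / 2 := by
      rw [Nat.cast_choose_two]; push_cast; ring
    rw [this]; ring
  · rw [div_eq_mul_inv semiγ, one_div, ← inv_pow, ← inv_pow, e]
    congr 1
    have e2 : ((3 + Real.sqrt 5) / 2) ^ 2 = (7 + 3 * Real.sqrt 5) / 2 := by
      linear_combination (1/4) * q
    have e3 : ((3 + Real.sqrt 5) / 2) ^ (2 + 1) = 9 + 4 * Real.sqrt 5 := by
      rw [pow_succ, e2]; linear_combination (3/4) * q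
    rw [e2, e3]
    unfold semiγ
    linear_combination (-(b - 3 * c) * 3 / 4) * q

lemma hasSum_w (f : ℤ × ℤ → ℝ) (a b : ℝ)
    (h1 : HasSum (fun n : ℕ => f (-(n:ℤ), 1) * (semiα * semiγ ^ n)) a)
    (h2 : HasSum (fun n : ℕ => f ((n:ℤ) + 1, -(n:ℤ)) * (semiα * semiγ ^ (n + 1))) b) :
    HasSum (fun d => f d * wSemi d) (a + b) := by
  let w1 : ℤ × ℤ → ℝ := fun d => if d.1 ≤ 0 ∧ d.2 = 1 then f d * wSemi d else 0
  let w2 : ℤ × ℤ → ℝ := fun d => if 1 ≤ d.1 ∧ d.2 = 1 - d.1 then f d * wSemi d else 0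
  have hw : (fun d => f d * wSemi d) = fun d => w1 d + w2 d := by
    funext d
    by_cases p : d.1 ≤ 0 ∧ d.2 = 1
    · have : ¬ (1 ≤ d.1 ∧ d.2 = 1 - d.1) := by omega
      simp only [w1, w2, if_pos p, if_neg this, add_zero]
    · by_cases r : 1 ≤ d.1 ∧ d.2 = 1 - d.1
      · simp only [w1, w2, if_neg p, if_pos r, zero_add]
      · simp only [w1, w2, wSemi, if_neg p, if_neg r, add_zero, mul_zero]
  rw [hw]
  refine HasSum.add ?_ ?_
  · have inj : Function.Injective (fun n : ℕ => ((-(n:ℤ), 1) : ℤ × ℤ)) := by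
      intro x y h
      simpa using h
    rw [← inj.hasSum_iff]
    · convert h1 using 1
      funext n
      simp [w1, wSemi]
    · rintro ⟨x, y⟩ hd
      refine if_neg ?_
      rintro ⟨p, r⟩
      apply hd
      refine ⟨(-x).toNat, ?_⟩
      simp only [Prod.mk.injEq] at *
      omega
  · have inj : Function.Injective (fun n : ℕ => (((n:ℤ) + 1, -(n:ℤ)) : ℤ × ℤ)) := by
      intro x y h
      simpa using h
    rw [← inj.hasSum_iff]
    · convert h2 using 1
      funext n
      have p : ¬ ((n:ℤ) + 1 ≤ 0 ∧ -(n:ℤ) = 1) := by omega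
      have r : 1 ≤ (n:ℤ) + 1 ∧ -(n:ℤ) = 1 - ((n:ℤ) + 1) := by omega
      have t : ((n:ℤ) + 1).toNat = n + 1 := by omega
      simp only [w2, wSemi, Function.comp, if_neg p, if_pos r, t]
    · rintro ⟨x, y⟩ hd
      refine if_neg ?_
      rintro ⟨p, r⟩
      apply hd
      refine ⟨(x - 1).toNat, ?_⟩
      simp only [Prod.mk.injEq] at *
      omega

lemma hasSum_final (f : ℤ × ℤ → ℝ) (a b c a' b' c' v : ℝ)
    (h1 : ∀ n : ℕ, f (-(n:ℤ), 1) = a + b * n + c * (n:ℝ)^2)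
    (h2 : ∀ n : ℕ, f ((n:ℤ) + 1, -(n:ℤ)) = a' + b' * n + c' * (n:ℝ)^2)
    (hv : semiα * (a * ((3 + Real.sqrt 5) / 2) + b * (2 + Real.sqrt 5)
        + c * (9 + 4 * Real.sqrt 5)) + semiγ * (semiα * (a' * ((3 + Real.sqrt 5) / 2)
        + b' * (2 + Real.sqrt 5) + c' * (9 + 4 * Real.sqrt 5))) = v) :
    HasSum (fun d => f d * wSemi d) v := by
  rw [← hv]
  apply hasSum_w
  · simp only [h1]; exact hasSum_poly a b c
  · simp only [h2]
    convert (hasSum_poly a' b' c').mul_left semiγ using 1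
    · rfl
    · funext n
      ring

lemma wSemi_nonneg (d : ℤ × ℤ) : 0 ≤ wSemi d := by
  have := semiα_pos
  have := semiγ_pos
  unfold wSemi
  split_ifs <;> positivity

/-- `μ_sb` is a centered probability distribution on `ℤ²` with
`E[X²] = 2(2+√5)`, `E[Y²] = 1+√5`, `E[XY] = -(2+√5)`, and correlation coefficient
`-(1+√5)/4`. -/
theorem semi_baxter_step_distribution_moments :
    (∀ d : ℤ × ℤ, 0 ≤ wSemi d) ∧
    (∑' d : ℤ × ℤ, wSemi d) = 1 ∧
    (∑' d : ℤ × ℤ, (d.1 : ℝ) * wSemi d) = 0 ∧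
    (∑' d : ℤ × ℤ, (d.2 : ℝ) * wSemi d) = 0 ∧
    (∑' d : ℤ × ℤ, (d.1 : ℝ)^2 * wSemi d) = 2 * (2 + Real.sqrt 5) ∧
    (∑' d : ℤ × ℤ, (d.2 : ℝ)^2 * wSemi d) = 1 + Real.sqrt 5 ∧
    (∑' d : ℤ × ℤ, (d.1 : ℝ) * (d.2 : ℝ) * wSemi d) = -(2 + Real.sqrt 5) ∧
    (∑' d : ℤ × ℤ, (d.1 : ℝ) * (d.2 : ℝ) * wSemi d) /
        (Real.sqrt (∑' d : ℤ × ℤ, (d.1 : ℝ)^2 * wSemi d) *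
          Real.sqrt (∑' d : ℤ × ℤ, (d.2 : ℝ)^2 * wSemi d))
      = -(1 + Real.sqrt 5) / 4 := by
  have p2 : Real.sqrt 5 ^ 2 = 5 := by rw [pow_two, aux_sq]
  have p3 : Real.sqrt 5 ^ 3 = 5 * Real.sqrt 5 := by rw [pow_succ, p2]
  have k0 : HasSum (fun d : ℤ × ℤ => (1:ℝ) * wSemi d) (1) := by
    refine hasSum_final (fun d => (1:ℝ)) 1 0 0 1 0 0 _ ?_ ?_ ?_
    · intro n; push_cast; ring
    · intro n; push_cast; ring
    · unfold semiα semiγ; ring_nf; simp only [p2, p3]; ring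
  have k1 : HasSum (fun d : ℤ × ℤ => (d.1:ℝ) * wSemi d) (0) := by
    refine hasSum_final (fun d => (d.1:ℝ)) 0 (-1) 0 1 1 0 _ ?_ ?_ ?_
    · intro n; push_cast; ring
    · intro n; push_cast; ring
    · unfold semiα semiγ; ring_nf; simp only [p2, p3]; ring
  have k2 : HasSum (fun d : ℤ × ℤ => (d.2:ℝ) * wSemi d) (0) := by
    refine hasSum_final (fun d => (d.2:ℝ)) 1 0 0 0 (-1) 0 _ ?_ ?_ ?_
    · intro n; push_cast; ring
    · intro n; push_cast; ring
    · unfold semiα semiγ; ring_nf; simp only [p2, p3]; ring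
  have k3 : HasSum (fun d : ℤ × ℤ => (d.1:ℝ)^2 * wSemi d) (2 * (2 + Real.sqrt 5)) := by
    refine hasSum_final (fun d => (d.1:ℝ)^2) 0 0 1 1 2 1 _ ?_ ?_ ?_
    · intro n; push_cast; ring
    · intro n; push_cast; ring
    · unfold semiα semiγ; ring_nf; simp only [p2, p3]; ring
  have k4 : HasSum (fun d : ℤ × ℤ => (d.2:ℝ)^2 * wSemi d) (1 + Real.sqrt 5) := by
    refine hasSum_final (fun d => (d.2:ℝ)^2) 1 0 0 0 0 1 _ ?_ ?_ ?_
    · intro n; push_cast; ring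
    · intro n; push_cast; ring
    · unfold semiα semiγ; ring_nf; simp only [p2, p3]; ring
  have k5 : HasSum (fun d : ℤ × ℤ => ((d.1:ℝ) * (d.2:ℝ)) * wSemi d) (-(2 + Real.sqrt 5)) := by
    refine hasSum_final (fun d => ((d.1:ℝ) * (d.2:ℝ))) 0 (-1) 0 0 (-1) (-1) _ ?_ ?_ ?_
    · intro n; push_cast; ring
    · intro n; push_cast; ring
    · unfold semiα semiγ; ring_nf; simp only [p2, p3]; ring
  simp only [one_mul] at k0
  refine ⟨wSemi_nonneg, k0.tsum_eq, k1.tsum_eq, k2.tsum_eq, k3.tsum_eq, k4.tsum_eq,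
    k5.tsum_eq, ?_⟩
  rw [k3.tsum_eq, k4.tsum_eq, k5.tsum_eq]
  have lo := aux_lo
  rw [← Real.sqrt_mul (by linarith)]
  have : 2 * (2 + Real.sqrt 5) * (1 + Real.sqrt 5) = (3 + Real.sqrt 5) ^ 2 := by
    linear_combination p2
  rw [this, Real.sqrt_sq (by linarith), div_eq_div_iff (by linarith) (by norm_num)]
  linear_combination p2
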